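/- arXiv:1504.08149 — 4 statements merged into one kernel-verified Lean document; each statement's English description precedes it below -/
import Mathlib

section
/- Let V be a real vector space of even finite dimension, and let C ⊆ Λ²V be an ample convex cone. Let ω be an alternating bilinear form on V whose induced linear functional ω̂ : Λ²V → ℝ (determined by ω̂(v ∧ w) = ω(v, w)) satisfies ω̂(P) > 0 for every nonzero P ∈ C. Then ω is nondegenerate, i.e., for every nonzero v ∈ V there exists w ∈ V with ω(v, w) ≠ 0. -/
/-- The bivector `v ∧ w`, as an element of the second exterior power `⋀[ℝ]^2 V`. -/
noncomputable def wedge2 {V : Type*} [AddCommGroup V] [Module ℝ V] (v w : V) :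
    ⋀[ℝ]^2 V :=
  ⟨ExteriorAlgebra.ιMulti ℝ 2 ![v, w],
    ExteriorAlgebra.ιMulti_range ℝ 2 (Set.mem_range_self _)⟩

namespace LinearMap

variable {K V : Type*} [Field K] [AddCommGroup V] [Module K V]

/-- A space carrying an alternating bilinear form with trivial left kernel is even-dimensional. -/
theorem IsAlt.even_finrank_of_separatingLeft [NeZero (2 : K)] [FiniteDimensional K V]
    {B : V →ₗ[K] V →ₗ[K] K} (hB : B.IsAlt)
    (hsep : B.SeparatingLeft) : Even (Module.finrank K V) := by
  by_contra hodd
  rw [Nat.not_even_iff_odd] at hodd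
  let b := Module.finBasis K V
  let M := LinearMap.toMatrix₂ b b B
  have hskew : M.transpose = -M := by
    ext i j
    simp [M, LinearMap.toMatrix₂_apply, hB.neg]
  have hdet : M.det = -M.det := by
    conv_lhs =>
      rw [← Matrix.det_transpose, hskew, Matrix.det_neg, Fintype.card_fin, hodd.neg_one_pow]
    ring
  have hzero : (2 : K) * M.det = 0 := by linear_combination hdet
  exact (separatingLeft_iff_det_ne_zero b).mp hsep
    ((mul_eq_zero.mp hzero).resolve_left two_ne_zero)

/-- An alternating bilinear form has even rank. -/
theorem IsAlt.even_finrank_range [NeZero (2 : K)] [FiniteDimensional K V]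
    {B : V →ₗ[K] V →ₗ[K] K} (hB : B.IsAlt) :
    Even (Module.finrank K (LinearMap.range B)) := by
  obtain ⟨W, hW⟩ := (LinearMap.ker B).exists_isCompl
  have hrank : Module.finrank K W = Module.finrank K (LinearMap.range B) := by
    have h₁ := Submodule.finrank_add_eq_of_isCompl hW
    have h₂ := B.finrank_range_add_finrank_ker
    omega
  rw [← hrank]
  have halt : (B.domRestrict₁₂ W W).IsAlt := fun x => hB x
  refine halt.even_finrank_of_separatingLeft fun x hx => ?_
  have hker : (x : V) ∈ LinearMap.ker B := by
    rw [LinearMap.mem_ker]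
    ext y
    obtain ⟨k, hk, w, hw, rfl⟩ := Submodule.mem_sup.mp (hW.sup_eq_top ▸ Submodule.mem_top (x := y))
    have hxk : B x k = 0 := by rw [hB.eq_iff, LinearMap.mem_ker.mp hk, LinearMap.zero_apply]
    rw [map_add, hxk, zero_add]
    exact hx ⟨w, hw⟩
  exact Subtype.ext (Submodule.disjoint_def.mp hW.disjoint _ hker x.2)

/-- An alternating bilinear form vanishes on any pair whose span meets its kernel nontrivially. -/
theorem IsAlt.apply_eq_zero_of_span_inf_ker_ne_bot {B : V →ₗ[K] V →ₗ[K] K} (hB : B.IsAlt)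
    {v w : V} (h : Submodule.span K {v, w} ⊓ LinearMap.ker B ≠ ⊥) : B v w = 0 := by
  obtain ⟨u, ⟨hu, hker⟩, hu0⟩ := Submodule.exists_mem_ne_zero_of_ne_bot h
  obtain ⟨a, b, rfl⟩ := Submodule.mem_span_pair.mp hu
  have hw := LinearMap.congr_fun (LinearMap.mem_ker.mp hker) w
  have hv := LinearMap.congr_fun (LinearMap.mem_ker.mp hker) v
  simp only [map_add, map_smul, LinearMap.add_apply, LinearMap.smul_apply, hB.self_eq_zero,
    ← hB.neg v w, LinearMap.zero_apply, smul_eq_mul, mul_zero, add_zero, zero_add, mul_neg,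
    neg_eq_zero, mul_eq_zero] at hv hw
  by_contra hvw
  exact hu0 (by simp [hw.resolve_right hvw, hv.resolve_right hvw])

end LinearMap

/-- On an even-dimensional real vector space `V`, any alternating bilinear form `ω` whose
induced linear functional on `⋀²V` is positive on the nonzero elements of an ample convex
cone `C ⊆ ⋀²V` is nondegenerate.  Ampleness means: for every 2-dimensional subspace
`τ ⊆ V`, the Schubert variety of `τ` (the nonzero decomposable bivectors `v ∧ w` with
`span{v, w} ∩ τ ≠ 0`) meets `C` in a nonzero element. -/
theorem nondegenerate_of_positive_on_ample_cone
    {V : Type*} [AddCommGroup V] [Module ℝ V] [FiniteDimensional ℝ V]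
    (hdim : Even (Module.finrank ℝ V))
    (C : ConvexCone ℝ (⋀[ℝ]^2 V))
    (hample : ∀ τ : Submodule ℝ V, Module.finrank ℝ τ = 2 →
      ∃ v w : V, wedge2 v w ∈ C ∧ wedge2 v w ≠ 0 ∧ Submodule.span ℝ {v, w} ⊓ τ ≠ ⊥)
    (ω : V →ₗ[ℝ] V →ₗ[ℝ] ℝ) (hωalt : ∀ v : V, ω v v = 0)
    (L : (⋀[ℝ]^2 V) →ₗ[ℝ] ℝ)
    (hL : ∀ v w : V, L (wedge2 v w) = ω v w)
    (hpos : ∀ P : ⋀[ℝ]^2 V, P ∈ C → P ≠ 0 → 0 < L P) :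
    ∀ v : V, v ≠ 0 → ∃ w : V, ω v w ≠ 0 := by
  have halt : ω.IsAlt := hωalt
  intro v hv
  by_contra! hvw
  have hvker : v ∈ LinearMap.ker ω := LinearMap.mem_ker.mpr (LinearMap.ext hvw)
  have hker : 2 ≤ Module.finrank ℝ (LinearMap.ker ω) := by
    have : Nontrivial (LinearMap.ker ω) := ⟨⟨v, hvker⟩, 0, fun h => hv (congrArg Subtype.val h)⟩
    have hone := Module.finrank_pos (R := ℝ) (M := LinearMap.ker ω)
    have hsum := ω.finrank_range_add_finrank_ker
    obtain ⟨m, hm⟩ := halt.even_finrank_range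
    obtain ⟨n, hn⟩ := hdim
    omega
  obtain ⟨f, hf⟩ := exists_linearIndependent_of_le_finrank hker
  let g : Fin 2 → V := fun i => f i
  let τ := Submodule.span ℝ (Set.range g)
  have hτker : τ ≤ LinearMap.ker ω :=
    Submodule.span_le.mpr (Set.range_subset_iff.mpr fun i => (f i).2)
  have hτ : Module.finrank ℝ τ = 2 := by
    have hg : LinearIndependent ℝ g := hf.map' _ (Submodule.ker_subtype _)
    simpa using finrank_span_eq_card hg
  obtain ⟨x, y, hC, hne, hmeet⟩ := hample τ hτ
  have hzero : ω x y = 0 := halt.apply_eq_zero_of_span_inf_ker_ne_bot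
    fun h => hmeet (eq_bot_mono (inf_le_inf_left _ hτker) h)
  have hxy := hpos _ hC hne
  rw [hL, hzero] at hxy
  exact hxy.false
end

section
/- Let V be a finite-dimensional real vector space, α : V → ℝ a linear form, and β an alternating bilinear form on V. Define the alternating bilinear form Ω on ℝ × V by Ω((s, v), (t, w)) = s·α(w) − t·α(v) + β(v, w). Then Ω is nondegenerate (its radical {(s, v) : Ω((s, v), (t, w)) = 0 for all (t, w)} is zero) if and only if α ≠ 0 and the restriction of β to ker α is nondegenerate (for every nonzero v ∈ ker α there exists w ∈ ker α with β(v, w) ≠ 0). -/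
/-- **Pointwise nondegeneracy of the twisted symplectization.**
Let `α : V → ℝ` be a linear form and `β` an alternating bilinear form on a
finite-dimensional real vector space `V`.  The alternating bilinear form
`Ω((s,v),(t,w)) = s·α(w) - t·α(v) + β(v,w)` on `ℝ × V` is nondegenerate (has zero radical)
if and only if `α ≠ 0` and the restriction of `β` to `ker α` is nondegenerate. -/
theorem twisted_symplectization_nondegenerate_iff
    {V : Type*} [AddCommGroup V] [Module ℝ V] [FiniteDimensional ℝ V]
    (α : V →ₗ[ℝ] ℝ) (β : V →ₗ[ℝ] V →ₗ[ℝ] ℝ) (hβalt : ∀ v : V, β v v = 0) :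
    (∀ p : ℝ × V, (∀ q : ℝ × V, p.1 * α q.2 - q.1 * α p.2 + β p.2 q.2 = 0) → p = 0) ↔
      (α ≠ 0 ∧ ∀ v ∈ LinearMap.ker α, v ≠ 0 →
        ∃ w ∈ LinearMap.ker α, β v w ≠ 0) := by
  constructor
  · intro h
    have hα : α ≠ 0 := by
      rintro rfl
      simpa using h (1, 0) (by simp)
    refine ⟨hα, fun v hv hv0 => ?_⟩
    by_contra! hker
    obtain ⟨u, hu⟩ : ∃ u, α u ≠ 0 := by
      by_contra! hzero
      exact hα (LinearMap.ext hzero)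
    have hv' : α v = 0 := hv
    refine hv0 (congrArg Prod.snd (h (-(β v u / α u), v) fun q => ?_))
    have hq := hker (q.2 - (α q.2 / α u) • u) (by simp [hu])
    simp only [map_sub, map_smul, smul_eq_mul] at hq
    simp only [hv', mul_zero, sub_zero]
    linear_combination hq
  · rintro ⟨hα, hker⟩ ⟨s, v⟩ h
    have hv : α v = 0 := by simpa using h (1, 0)
    have hv0 : v = 0 := by
      by_contra hne
      obtain ⟨w, hw, hβ⟩ := hker v hv hne
      have hw' : α w = 0 := hw
      exact hβ (by simpa [hw'] using h (0, w))
    subst hv0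
    have hs : s = 0 := by
      by_contra hs
      exact hα (LinearMap.ext fun w => by simpa [hs] using h (0, w))
    simp [hs]
end

section
/- Let V be a finite-dimensional real inner product space and ω a nondegenerate alternating bilinear form on V. Then there exists a linear map J : V → V with J ∘ J = −id which is compatible with ω, i.e., ω(J x, J y) = ω(x, y) for all x, y ∈ V and ω(x, J x) > 0 for every nonzero x ∈ V. Such a J is obtained by setting J = A Q^{-1}, where A : V → V is the skew-adjoint map defined by ⟨x, y⟩ = ω(A x, y) and Q = √(−A²) is the positive-definite square root of −A² = A*A. -/
open RealInnerProductSpace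

/-- A positive definite symmetric operator `S` on a finite-dimensional real inner product space
has an inverse square root: a positive definite symmetric `R` with `R ∘ R ∘ S = id`, commuting with
every operator that commutes with `S`. -/
theorem LinearMap.IsSymmetric.exists_inverse_sqrt
    {V : Type*} [NormedAddCommGroup V] [InnerProductSpace ℝ V] [FiniteDimensional ℝ V]
    {S : V →ₗ[ℝ] V} (hS : S.IsSymmetric) (hpos : ∀ x : V, x ≠ 0 → 0 < ⟪S x, x⟫) :
    ∃ R : V →ₗ[ℝ] V, R.IsSymmetric ∧ (∀ x, R (R (S x)) = x) ∧
      (∀ x : V, x ≠ 0 → 0 < ⟪R x, x⟫) ∧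
      ∀ B : V →ₗ[ℝ] V, (∀ x, B (S x) = S (B x)) → ∀ x, B (R x) = R (B x) := by
  let b := hS.eigenvectorBasis rfl
  let μ := hS.eigenvalues rfl
  have hSb : ∀ i, S (b i) = μ i • b i := fun i => hS.apply_eigenvectorBasis rfl i
  have hμ : ∀ i, 0 < μ i := by
    intro i
    have h := hpos (b i) (b.orthonormal.ne_zero i)
    simpa [hSb, real_inner_smul_left] using h
  let c := fun i => (√(μ i))⁻¹
  have hc : ∀ i, 0 < c i := fun i => inv_pos.2 (Real.sqrt_pos.2 (hμ i))
  have hcc : ∀ i, c i * (c i * μ i) = 1 := by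
    intro i
    have h := Real.mul_self_sqrt (hμ i).le
    have h' := (Real.sqrt_pos.2 (hμ i)).ne'
    simp only [c]
    field_simp
    linarith
  let R : V →ₗ[ℝ] V := b.toBasis.constr ℝ (fun i => c i • b i)
  have hRb : ∀ i, R (b i) = c i • b i := fun i => by
    rw [← b.coe_toBasis, b.toBasis.constr_basis, b.coe_toBasis]
  have hcoord : ∀ x i, ⟪b i, R x⟫ = c i * ⟪b i, x⟫ := by
    intro x i
    have h : (innerₗ V (b i)) ∘ₗ R = c i • innerₗ V (b i) := by
      refine b.toBasis.ext fun j => ?_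
      by_cases hij : i = j
      · subst hij; simp [hRb]
      · simp [hRb, b.inner_eq_zero hij]
    simpa using LinearMap.congr_fun h x
  have hScoord : ∀ x i, ⟪b i, S x⟫ = μ i * ⟪b i, x⟫ := by
    intro x i
    rw [← hS, hSb, real_inner_smul_left]
  have hext : ∀ {x y : V}, (∀ i, ⟪b i, x⟫ = ⟪b i, y⟫) → x = y := fun h =>
    InnerProductSpace.ext_inner_left_basis b.toBasis (by simpa using h)
  refine ⟨R, ?_, ?_, ?_, ?_⟩
  · intro x y
    rw [← b.sum_inner_mul_inner, ← b.sum_inner_mul_inner]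
    refine Finset.sum_congr rfl fun i _ => ?_
    rw [real_inner_comm, hcoord, hcoord, real_inner_comm x]
    ring
  · refine fun x => hext fun i => ?_
    rw [hcoord, hcoord, hScoord]
    linear_combination ⟪b i, x⟫ * hcc i
  · intro x hx
    have hsum : ⟪R x, x⟫ = ∑ i, c i * ⟪b i, x⟫ ^ 2 := by
      rw [← b.sum_inner_mul_inner]
      refine Finset.sum_congr rfl fun i _ => ?_
      rw [real_inner_comm, hcoord]
      ring
    rw [hsum]
    obtain ⟨i, hi⟩ : ∃ i, ⟪b i, x⟫ ≠ 0 := by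
      by_contra! h
      exact hx (hext fun i => by simpa using h i)
    exact Finset.sum_pos' (fun j _ => mul_nonneg (hc j).le (sq_nonneg _))
      ⟨i, Finset.mem_univ i, mul_pos (hc i) (by positivity)⟩
  · intro B hB x
    have h : B ∘ₗ R = R ∘ₗ B := by
      refine b.toBasis.ext fun j => hext fun i => ?_
      have h := congrArg (fun z => ⟪b i, z⟫) (hB (b j))
      simp only [hSb, map_smul, real_inner_smul_right, hScoord] at h
      simp only [LinearMap.comp_apply, OrthonormalBasis.coe_toBasis, hRb, map_smul,
        real_inner_smul_right, hcoord]
      by_cases h0 : ⟪b i, B (b j)⟫ = 0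
      · simp [h0]
      · simp only [c, mul_right_cancel₀ h0 h]
    exact LinearMap.congr_fun h x

/-- On a finite-dimensional real inner product space, every nondegenerate alternating
bilinear form `ω` admits a compatible complex structure: a linear map `J` with
`J ∘ J = -id`, `ω(J x, J y) = ω(x, y)` for all `x, y`, and `ω(x, J x) > 0` for all
nonzero `x`.  (Such a `J` is obtained by polar decomposition, `J = A Q⁻¹` with
`⟪x, y⟫ = ω(A x, y)` and `Q = √(-A²)`.) -/
theorem exists_compatible_complex_structure
    {V : Type*} [NormedAddCommGroup V] [InnerProductSpace ℝ V] [FiniteDimensional ℝ V]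
    (ω : V →ₗ[ℝ] V →ₗ[ℝ] ℝ) (hωalt : ∀ v : V, ω v v = 0)
    (hωnd : ∀ v : V, v ≠ 0 → ∃ w : V, ω v w ≠ 0) :
    ∃ J : V →ₗ[ℝ] V,
      J ∘ₗ J = -LinearMap.id ∧
      (∀ x y : V, ω (J x) (J y) = ω x y) ∧
      (∀ x : V, x ≠ 0 → 0 < ω x (J x)) := by
  obtain ⟨B, hB⟩ : ∃ B : V →ₗ[ℝ] V, ∀ x y, ⟪B x, y⟫ = ω x y :=
    ⟨(InnerProductSpace.toDual ℝ V).symm.toLinearEquiv.toLinearMap ∘ₗ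
      LinearMap.toContinuousLinearMap.toLinearMap ∘ₗ ω,
      fun x y => by simp [InnerProductSpace.toDual_symm_apply]⟩
  have hskew : ∀ x y, ⟪B x, y⟫ = -⟪x, B y⟫ := by
    intro x y
    rw [real_inner_comm (B y), hB, hB]
    exact (LinearMap.IsAlt.neg hωalt y x).symm
  have hinj : ∀ x, x ≠ 0 → B x ≠ 0 := by
    intro x hx h
    obtain ⟨w, hw⟩ := hωnd x hx
    exact hw (by rw [← hB, h, inner_zero_left])
  obtain ⟨R, hRsymm, hRS, hRpos, hRcomm⟩ :=
    LinearMap.IsSymmetric.exists_inverse_sqrt (S := -(B ∘ₗ B))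
      (fun x y => by simp [hskew])
      (fun x hx => by
        have h : ⟪(-(B ∘ₗ B)) x, x⟫ = ⟪B x, B x⟫ := by simp [hskew (B x) x]
        rw [h]
        exact real_inner_self_pos.2 (hinj x hx))
  have hBR : ∀ x, B (R x) = R (B x) := hRcomm B fun x => by simp
  have hJ : ∀ x, R (B (R (B x))) = -x := fun x => by
    rw [hBR, ← neg_eq_iff_eq_neg]
    simpa using hRS x
  refine ⟨R ∘ₗ B, LinearMap.ext hJ, fun x y => ?_, fun x hx => ?_⟩
  · rw [← hB, ← hB, LinearMap.comp_apply, LinearMap.comp_apply, ← hRsymm, hJ, hskew x y,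
      inner_neg_left]
  · rw [← hB, LinearMap.comp_apply, ← hRsymm]
    exact hRpos _ (hinj x hx)
end

section
/- Let V be a finite-dimensional real inner product space, ω a nondegenerate alternating bilinear form on V, and T : V → V a linear involution (T ∘ T = id) which preserves the inner product (⟨T x, T y⟩ = ⟨x, y⟩ for all x, y) and anti-preserves ω (ω(T x, T y) = −ω(x, y) for all x, y). Then there exists a linear map J : V → V with J ∘ J = −id, compatible with ω (ω(J x, J y) = ω(x, y) for all x, y and ω(x, J x) > 0 for every nonzero x), and such that T ∘ J ∘ T = −J. -/
open RealInnerProductSpace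

/-- A polynomial in a symmetric endomorphism of a real inner product space is symmetric. -/
theorem LinearMap.IsSymmetric.polynomial_aeval
    {V : Type*} [NormedAddCommGroup V] [InnerProductSpace ℝ V]
    {S : Module.End ℝ V} (hS : S.IsSymmetric) (p : Polynomial ℝ) :
    (Polynomial.aeval S p).IsSymmetric := by
  induction p using Polynomial.induction_on' with
  | add p q hp hq => rw [map_add]; exact hp.add hq
  | monomial n a =>
    intro x y
    simp [Polynomial.aeval_monomial, Module.algebraMap_end_apply, inner_smul_left,
      inner_smul_right, hS.pow n x y]

/-- A positive definite endomorphism has an inverse fourth root which is a polynomial in it. -/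
theorem LinearMap.IsSymmetric.exists_aeval_pow_four_mul_eq_one
    {V : Type*} [NormedAddCommGroup V] [InnerProductSpace ℝ V] [FiniteDimensional ℝ V]
    {S : Module.End ℝ V} (hS : S.IsSymmetric) (hpos : ∀ x : V, x ≠ 0 → 0 < ⟪x, S x⟫) :
    ∃ p : Polynomial ℝ, Polynomial.aeval S p ^ 4 * S = 1 := by
  classical
  let ev := hS.eigenvalues rfl
  let b := hS.eigenvectorBasis rfl
  have hev : ∀ i, S (b i) = ev i • b i := fun i ↦ hS.apply_eigenvectorBasis rfl i
  have hevpos : ∀ i, 0 < ev i := fun i ↦ by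
    have h := hpos (b i) (b.orthonormal.ne_zero i)
    rwa [hev, inner_smul_right, real_inner_self_eq_norm_sq, b.orthonormal.1 i, one_pow,
      mul_one] at h
  let s := Finset.univ.image ev
  let f : ℝ → ℝ := fun t ↦ (√(√t))⁻¹
  let p := Lagrange.interpolate s _root_.id f
  refine ⟨p, b.toBasis.ext fun i ↦ ?_⟩
  have hp : p.eval (ev i) = f (ev i) :=
    Lagrange.eval_interpolate_at_node (s := s) (v := _root_.id) f Function.injective_id.injOn
      (Finset.mem_image_of_mem ev (Finset.mem_univ i))
  have hb : Module.End.HasEigenvector S (ev i) (b i) :=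
    hS.hasEigenvector_eigenvectorBasis rfl i
  have hfour : √(√(ev i)) ^ 4 = ev i := by
    rw [show 4 = 2 * 2 from rfl, pow_mul, Real.sq_sqrt (Real.sqrt_nonneg _),
      Real.sq_sqrt (hevpos i).le]
  rw [OrthonormalBasis.coe_toBasis, Module.End.mul_apply, hev, map_smul, ← map_pow,
    Module.End.aeval_apply_of_hasEigenvector hb, Polynomial.eval_pow, hp, smul_smul,
    inv_pow, hfour, mul_inv_cancel₀ (hevpos i).ne', one_smul, Module.End.one_apply]

/-- **Existence of a skew-invariant compatible complex structure.**
Let `V` be a finite-dimensional real inner product space, `ω` a nondegenerate alternating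
bilinear form on `V`, and `T` a linear involution preserving the inner product and
anti-preserving `ω`.  Then there exists `J` with `J ∘ J = -id`, compatible with `ω`
(`ω(J x, J y) = ω(x, y)` and `ω(x, J x) > 0` for `x ≠ 0`), such that `T ∘ J ∘ T = -J`. -/
theorem exists_skew_invariant_compatible_complex_structure
    {V : Type*} [NormedAddCommGroup V] [InnerProductSpace ℝ V] [FiniteDimensional ℝ V]
    (ω : V →ₗ[ℝ] V →ₗ[ℝ] ℝ) (hωalt : ∀ v : V, ω v v = 0)
    (hωnd : ∀ v : V, v ≠ 0 → ∃ w : V, ω v w ≠ 0)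
    (T : V →ₗ[ℝ] V) (hTinv : T ∘ₗ T = LinearMap.id)
    (hTinner : ∀ x y : V, ⟪T x, T y⟫ = ⟪x, y⟫)
    (hTω : ∀ x y : V, ω (T x) (T y) = -ω x y) :
    ∃ J : V →ₗ[ℝ] V,
      J ∘ₗ J = -LinearMap.id ∧
      (∀ x y : V, ω (J x) (J y) = ω x y) ∧
      (∀ x : V, x ≠ 0 → 0 < ω x (J x)) ∧
      T ∘ₗ J ∘ₗ T = -J := by
  let A : Module.End ℝ V :=
    (InnerProductSpace.toDual ℝ V).symm.toLinearEquiv.toLinearMap ∘ₗ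
      LinearMap.toContinuousLinearMap.toLinearMap ∘ₗ ω
  have hA : ∀ x y, ⟪A x, y⟫ = ω x y := fun x y ↦ by
    simp [A]
  have hskew : ∀ x y, ⟪A x, y⟫ = -⟪x, A y⟫ := fun x y ↦ by
    have h := hωalt (x + y)
    simp only [map_add, LinearMap.add_apply, hωalt] at h
    rw [hA, ← real_inner_comm, hA]
    linarith
  have hA0 : ∀ x, x ≠ 0 → A x ≠ 0 := fun x hx h ↦ by
    obtain ⟨w, hw⟩ := hωnd x hx
    exact hw (by rw [← hA, h, inner_zero_left])
  have hTT : ∀ x, T (T x) = x := fun x ↦ LinearMap.congr_fun hTinv x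
  have hTA : ∀ x, A (T x) = -T (A x) := fun x ↦ by
    refine ext_inner_right ℝ fun y ↦ ?_
    rw [hA, ← hTT y, hTω, inner_neg_left, hTinner, hA]
  have hS : (-(A * A)).IsSymmetric := fun x y ↦ by
    simp [hskew]
  have hSpos : ∀ x, x ≠ 0 → 0 < ⟪x, (-(A * A)) x⟫ := fun x hx ↦ by
    have h := real_inner_self_pos.2 (hA0 x hx)
    rw [hskew] at h
    simpa using h
  obtain ⟨p, hp⟩ := hS.exists_aeval_pow_four_mul_eq_one hSpos
  have hQ := hS.polynomial_aeval p
  have hAQ : Commute A (Polynomial.aeval (-(A * A)) p) :=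
    Algebra.commute_of_mem_adjoin_singleton_of_commute
      (Polynomial.aeval_mem_adjoin_singleton ℝ _)
      ((Commute.refl A).mul_right (Commute.refl A)).neg_right
  have hTQ : Commute T (Polynomial.aeval (-(A * A)) p) :=
    Algebra.commute_of_mem_adjoin_singleton_of_commute
      (Polynomial.aeval_mem_adjoin_singleton ℝ _)
      (LinearMap.ext fun x ↦ by simp [hTA])
  generalize Polynomial.aeval (-(A * A)) p = Q at hp hQ hAQ hTQ
  have hAQ' : ∀ x, A (Q x) = Q (A x) := fun x ↦ LinearMap.congr_fun hAQ.eq x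
  have hTQ' : ∀ x, T (Q x) = Q (T x) := fun x ↦ LinearMap.congr_fun hTQ.eq x
  have hroot : ∀ x, Q (Q (Q (Q (A (A x))))) = -x := fun x ↦ by
    have h := LinearMap.congr_fun hp x
    simp only [pow_succ, pow_zero, one_mul, Module.End.mul_apply, LinearMap.neg_apply, map_neg,
      Module.End.one_apply] at h
    exact neg_eq_iff_eq_neg.1 h
  have hQ0 : ∀ x, x ≠ 0 → Q x ≠ 0 := fun x hx h ↦ hx <| by
    simpa [← hAQ', h] using hroot x
  refine ⟨A * Q * Q, ?_, fun x y ↦ ?_, fun x hx ↦ ?_, ?_⟩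
  · ext x
    simp [hAQ', hroot]
  · simp only [← hA, Module.End.mul_apply]
    rw [hskew, hAQ', hAQ', hAQ', hAQ', hQ, hQ, hskew]
    simp [hAQ', hroot, hskew]
  · rw [← hA, Module.End.mul_apply, Module.End.mul_apply, hAQ', hAQ', ← hQ, ← hAQ']
    exact real_inner_self_pos.2 (hA0 _ (hQ0 x hx))
  · ext x
    simp [hTQ', hTA, hTT, hAQ']
end
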